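/- arXiv:2004.14102 — 9 statements merged into one kernel-verified Lean document; each statement's English description precedes it below -/
import Mathlib

section
/- Let G be a finite simple graph and let T₁, T₂ be two disjoint nonempty subsets of V(G) such that every vertex of T₁ has strictly more than |T₂|/2 neighbours in T₂ and every vertex of T₂ has strictly more than |T₁|/2 neighbours in T₁. Then the subgraph of G induced by T₁ ∪ T₂ is connected. -/
/-- If `u` and `v` each have more than half of `S` as neighbours, they have a common neighbour
in `S`. -/
theorem SimpleGraph.exists_common_neighbor_mem_of_half_card_lt {V : Type*}
    (G : SimpleGraph V) [DecidableRel G.Adj] {S : Finset V} {u v : V}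
    (hu : (S.card : ℝ) / 2 < ((S.filter (fun w => G.Adj u w)).card : ℝ))
    (hv : (S.card : ℝ) / 2 < ((S.filter (fun w => G.Adj v w)).card : ℝ)) :
    ∃ w ∈ S, G.Adj u w ∧ G.Adj v w := by
  classical
  have hlt : S.card < (S.filter (fun w => G.Adj u w)).card +
      (S.filter (fun w => G.Adj v w)).card := by
    have : (S.card : ℝ) < ((S.filter (fun w => G.Adj u w)).card : ℝ) +
        ((S.filter (fun w => G.Adj v w)).card : ℝ) := by linarith
    exact_mod_cast this
  obtain ⟨w, hw⟩ := Finset.inter_nonempty_of_card_lt_card_add_card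
    (Finset.filter_subset _ S) (Finset.filter_subset _ S) hlt
  simp only [Finset.mem_inter, Finset.mem_filter] at hw
  exact ⟨w, hw.1.1, hw.1.2, hw.2.2⟩

/-- If `T₁, T₂` are disjoint nonempty vertex sets of a finite simple graph `G`
such that every vertex of `T₁` has strictly more than `|T₂|/2` neighbours in `T₂` and
every vertex of `T₂` has strictly more than `|T₁|/2` neighbours in `T₁`, then the subgraph
of `G` induced by `T₁ ∪ T₂` is connected. -/
theorem dense_pair_induced_connected {V : Type*} [Fintype V] [DecidableEq V]
    (G : SimpleGraph V) [DecidableRel G.Adj]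
    (T₁ T₂ : Finset V) (hdisj : Disjoint T₁ T₂)
    (h1 : T₁.Nonempty) (h2 : T₂.Nonempty)
    (hd1 : ∀ v ∈ T₁, ((T₂.card : ℝ) / 2) < ((T₂.filter (fun w => G.Adj v w)).card : ℝ))
    (hd2 : ∀ v ∈ T₂, ((T₁.card : ℝ) / 2) < ((T₁.filter (fun w => G.Adj v w)).card : ℝ)) :
    (G.induce ((T₁ ∪ T₂ : Finset V) : Set V)).Connected := by
  obtain ⟨r, hr⟩ := h1
  have reach_adj {u v : V} (hu : u ∈ ((T₁ ∪ T₂ : Finset V) : Set V))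
      (hv : v ∈ ((T₁ ∪ T₂ : Finset V) : Set V)) (huv : G.Adj u v) :
      (G.induce ((T₁ ∪ T₂ : Finset V) : Set V)).Reachable ⟨u, hu⟩ ⟨v, hv⟩ :=
    SimpleGraph.Adj.reachable (SimpleGraph.induce_adj.mpr huv)
  have reach_left (v : V) (hv : v ∈ T₁) :
      (G.induce ((T₁ ∪ T₂ : Finset V) : Set V)).Reachable
        ⟨r, by simp [hr]⟩ ⟨v, by simp [hv]⟩ := by
    obtain ⟨w, hw, hrw, hvw⟩ :=
      G.exists_common_neighbor_mem_of_half_card_lt (hd1 r hr) (hd1 v hv)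
    have hw' : w ∈ ((T₁ ∪ T₂ : Finset V) : Set V) := by simp [hw]
    exact (reach_adj _ hw' hrw).trans (reach_adj hw' _ hvw.symm)
  rw [SimpleGraph.connected_iff_exists_forall_reachable]
  refine ⟨⟨r, by simp [hr]⟩, ?_⟩
  rintro ⟨v, hv⟩
  rcases Finset.mem_union.mp (Finset.mem_coe.mp hv) with hv₁ | hv₂
  · exact reach_left v hv₁
  · obtain ⟨w, hw, hvw, -⟩ :=
      G.exists_common_neighbor_mem_of_half_card_lt (hd2 v hv₂) (hd2 v hv₂)
    exact (reach_left w hw).trans (reach_adj _ hv hvw.symm)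
end

section
/- Let G be a finite simple graph and let T₁,…,T_m (m ≥ 2) be pairwise disjoint nonempty subsets of V(G) such that for all i ≠ j, every vertex of T_i has at least |T_j|/2 neighbours in T_j. Then the subgraph of G induced by T₁ ∪ … ∪ T_m has at most two connected components. -/
/-- A connected component of the subgraph induced by `⋃ i, T i` contains at least half of the
vertices of each `T j`. -/
theorem card_le_two_mul_card_component_inter {V ι : Type*} [Nontrivial ι]
    (G : SimpleGraph V) [DecidableRel G.Adj] (T : ι → Finset V)
    (hne : ∀ i, (T i).Nonempty)
    (hdense : ∀ i j, i ≠ j → ∀ v ∈ T i,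
      (T j).card ≤ 2 * ((T j).filter (fun w => G.Adj v w)).card)
    (c : (G.induce (⋃ i, (T i : Set V))).ConnectedComponent) (j : ι) :
    (T j).card ≤ 2 * (open Classical in (T j).filter (fun w => ∃ h,
      (G.induce (⋃ i, (T i : Set V))).connectedComponentMk ⟨w, h⟩ = c)).card := by
  classical
  have of_ne : ∀ i k, i ≠ k → ∀ v ∈ T i, ∀ h,
      (G.induce (⋃ i, (T i : Set V))).connectedComponentMk ⟨v, h⟩ = c →
      (T k).card ≤ 2 * ((T k).filter (fun w => ∃ h,
        (G.induce (⋃ i, (T i : Set V))).connectedComponentMk ⟨w, h⟩ = c)).card := by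
    intro i k hik v hv h hc
    refine (hdense i k hik v hv).trans (Nat.mul_le_mul_left 2 (Finset.card_le_card ?_))
    intro w hw
    rw [Finset.mem_filter] at hw ⊢
    refine ⟨hw.1, Set.mem_iUnion.2 ⟨k, hw.1⟩, ?_⟩
    rw [← hc, SimpleGraph.ConnectedComponent.eq]
    exact SimpleGraph.Adj.reachable (SimpleGraph.induce_adj.2 hw.2.symm)
  obtain ⟨⟨v, hv⟩, rfl⟩ := c.exists_rep
  obtain ⟨i, hi⟩ := Set.mem_iUnion.1 hv
  by_cases hij : i = j
  · subst hij
    obtain ⟨k, hk⟩ := exists_ne i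
    have hcard := of_ne i k hk.symm v hi hv rfl
    have hpos := (hne k).card_pos
    obtain ⟨w, hw⟩ := Finset.card_pos.1 (pos_of_mul_pos_right (hpos.trans_le hcard) (Nat.zero_le 2))
    obtain ⟨hwk, h, hc⟩ := Finset.mem_filter.1 hw
    exact of_ne k i hk w hwk h hc
  · exact of_ne i j hij v hi hv rfl


/-- If `T₁, …, T_m` (`m ≥ 2`) are pairwise disjoint nonempty vertex sets of a
finite simple graph `G` such that for all `i ≠ j` every vertex of `T i` has at least
`|T j|/2` neighbours in `T j`, then the subgraph of `G` induced by `T₁ ∪ … ∪ T_m` has at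
most two connected components. -/
theorem dense_family_at_most_two_components {V : Type*} [Fintype V] [DecidableEq V]
    (G : SimpleGraph V) [DecidableRel G.Adj]
    {m : ℕ} (hm : 2 ≤ m) (T : Fin m → Finset V)
    (hdisj : ∀ i j, i ≠ j → Disjoint (T i) (T j))
    (hne : ∀ i, (T i).Nonempty)
    (hdense : ∀ i j, i ≠ j → ∀ v ∈ T i,
      ((T j).card : ℝ) / 2 ≤ (((T j).filter (fun w => G.Adj v w)).card : ℝ)) :
    Nat.card ((G.induce (⋃ i, ((T i : Set V)))).ConnectedComponent) ≤ 2 := by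
  classical
  have : Nontrivial (Fin m) := Fin.nontrivial_iff_two_le.2 hm
  have hdense' : ∀ i j, i ≠ j → ∀ v ∈ T i,
      (T j).card ≤ 2 * ((T j).filter (fun w => G.Adj v w)).card := by
    intro i j hij v hv
    have h := hdense i j hij v hv
    have h' : ((T j).card : ℝ) ≤ 2 * ((T j).filter (fun w => G.Adj v w)).card := by linarith
    exact_mod_cast h'
  have half := card_le_two_mul_card_component_inter G T hne hdense'
  have hpos := (hne ⟨0, by omega⟩).card_pos
  set S := T ⟨0, by omega⟩
  rw [Nat.card_eq_fintype_card]
  refine Nat.le_of_mul_le_mul_right ?_ hpos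
  calc _ = ∑ c : (G.induce (⋃ i, (T i : Set V))).ConnectedComponent, S.card := by simp
    _ ≤ ∑ c, 2 * (S.filter (fun w => ∃ h,
          (G.induce (⋃ i, (T i : Set V))).connectedComponentMk ⟨w, h⟩ = c)).card :=
        Finset.sum_le_sum fun c _ => half c _
    _ = 2 * (Finset.univ.biUnion fun c => S.filter (fun w => ∃ h,
          (G.induce (⋃ i, (T i : Set V))).connectedComponentMk ⟨w, h⟩ = c)).card := by
        rw [← Finset.mul_sum, Finset.card_biUnion]
        intro c _ d _ hcd
        refine Finset.disjoint_filter.2 ?_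
        rintro w _ ⟨_, rfl⟩ ⟨_, hd⟩
        exact hcd hd
    _ ≤ 2 * S.card := Nat.mul_le_mul_left 2 (Finset.card_le_card
        (Finset.biUnion_subset.2 fun _ _ => Finset.filter_subset _ _))
end

section
/- Let G be a finite simple graph and let T₁,…,T_m (m ≥ 2) be pairwise disjoint nonempty subsets of V(G) such that for all i ≠ j, every vertex of T_i has at least |T_j|/2 neighbours in T_j. Then every connected component C of the subgraph of G induced by T₁ ∪ … ∪ T_m satisfies |C ∩ T_i| ≥ |T_i|/2 for every i ∈ {1,…,m}. -/
/-- The neighbours of a vertex of a component `C` of `G.induce s` that lie in a subset `A` of `s`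
are vertices of `C`. -/
theorem card_filter_adj_le_ncard_supp {V : Type*} [Fintype V]
    (G : SimpleGraph V) [DecidableRel G.Adj] {s : Set V} {A : Finset V} (hA : (A : Set V) ⊆ s)
    (C : (G.induce s).ConnectedComponent) {v : s} (hv : v ∈ C.supp) :
    (A.filter (fun w => G.Adj v w)).card ≤ {u ∈ C.supp | (u : V) ∈ A}.ncard := by
  rw [← Set.ncard_coe_finset, ← Set.ncard_image_of_injective _ Subtype.val_injective]
  refine Set.ncard_le_ncard (fun w hw => ?_) (Set.toFinite _)
  obtain ⟨hwA, hadj⟩ := Finset.mem_filter.mp (Finset.mem_coe.mp hw)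
  have h : (G.induce s).Adj v ⟨w, hA hwA⟩ := hadj
  exact ⟨⟨w, hA hwA⟩, ⟨C.mem_supp_of_adj_mem_supp hv h, hwA⟩, rfl⟩

/-- If `T₁, …, T_m` (`m ≥ 2`) are pairwise disjoint nonempty vertex sets of a
finite simple graph `G` such that for all `i ≠ j` every vertex of `T i` has at least
`|T j|/2` neighbours in `T j`, then every connected component `C` of the subgraph of `G`
induced by `T₁ ∪ … ∪ T_m` satisfies `|C ∩ T i| ≥ |T i|/2` for every `i`. -/
theorem dense_family_component_half {V : Type*} [Fintype V] [DecidableEq V]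
    (G : SimpleGraph V) [DecidableRel G.Adj]
    {m : ℕ} (hm : 2 ≤ m) (T : Fin m → Finset V)
    (hdisj : ∀ i j, i ≠ j → Disjoint (T i) (T j))
    (hne : ∀ i, (T i).Nonempty)
    (hdense : ∀ i j, i ≠ j → ∀ v ∈ T i,
      ((T j).card : ℝ) / 2 ≤ (((T j).filter (fun w => G.Adj v w)).card : ℝ)) :
    ∀ C : (G.induce (⋃ i, ((T i : Set V)))).ConnectedComponent, ∀ i : Fin m,
      ((T i).card : ℝ) / 2 ≤ (({v ∈ C.supp | (v : V) ∈ T i}).ncard : ℝ) := by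
  intro C i
  have hsub : ∀ j, (T j : Set V) ⊆ ⋃ i, (T i : Set V) :=
    fun j => Set.subset_iUnion (fun i => (T i : Set V)) j
  have half_of_mem : ∀ j k, k ≠ j → ∀ v ∈ C.supp, (v : V) ∈ T k →
      ((T j).card : ℝ) / 2 ≤ ({u ∈ C.supp | (u : V) ∈ T j}.ncard : ℝ) :=
    fun j k hkj v hv hvk => (hdense k j hkj v hvk).trans
      (by exact_mod_cast card_filter_adj_le_ncard_supp G (hsub j) C hv)
  obtain ⟨v, hv⟩ := C.nonempty_supp
  obtain ⟨k, hvk⟩ := Set.mem_iUnion.mp v.2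
  by_cases hki : k = i
  · subst hki
    have : Nontrivial (Fin m) := Fin.nontrivial_iff_two_le.mpr hm
    obtain ⟨j, hjk⟩ := exists_ne k
    have hpos : (0 : ℝ) < {u ∈ C.supp | (u : V) ∈ T j}.ncard := by
      have : (0 : ℝ) < (T j).card := by exact_mod_cast (hne j).card_pos
      linarith [half_of_mem j k hjk.symm v hv hvk]
    obtain ⟨w, hw, hwj⟩ := Set.nonempty_of_ncard_ne_zero (Nat.cast_pos.mp hpos).ne'
    exact half_of_mem k j hjk w hw hwj
  · exact half_of_mem i k hki v hv hvk
end

section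
/- Let G be a finite simple graph and let T₁,…,T_m (m ≥ 2) be pairwise disjoint nonempty subsets of V(G) such that for all i ≠ j, every vertex of T_i has at least |T_j|/2 neighbours in T_j. Suppose the subgraph of G induced by T₁ ∪ … ∪ T_m is disconnected, with connected components C₁ and C₂. Then for each ℓ ∈ {1,2} and each i ∈ {1,…,m} we have |C_ℓ ∩ T_i| = |T_i|/2, and moreover for all i ≠ j and each ℓ ∈ {1,2}, every vertex of C_ℓ ∩ T_i is adjacent in G to every vertex of C_ℓ ∩ T_j. -/
open Classical in
/-- The vertices of `A` lying in the component `C` of the induced subgraph on `s`. -/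
noncomputable def componentPart {V : Type*} {G : SimpleGraph V} {s : Set V}
    (C : (G.induce s).ConnectedComponent) (A : Finset V) : Finset V :=
  A.filter (fun w => ∃ h : w ∈ s, (G.induce s).connectedComponentMk ⟨w, h⟩ = C)

theorem mem_componentPart {V : Type*} {G : SimpleGraph V} {s : Set V}
    {C : (G.induce s).ConnectedComponent} {A : Finset V} {w : V} :
    w ∈ componentPart C A ↔
      w ∈ A ∧ ∃ h : w ∈ s, (G.induce s).connectedComponentMk ⟨w, h⟩ = C := by
  classical
  simp [componentPart]

theorem ncard_supp_inter {V : Type*} {G : SimpleGraph V} {s : Set V}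
    (C : (G.induce s).ConnectedComponent) (A : Finset V) :
    ({v ∈ C.supp | (v : V) ∈ A}).ncard = (componentPart C A).card := by
  rw [← Set.ncard_image_of_injective _ Subtype.val_injective, ← Set.ncard_coe_finset]
  congr 1
  ext w
  simp only [Set.mem_image, Set.mem_ofPred_eq, SimpleGraph.ConnectedComponent.mem_supp_iff,
    Finset.mem_coe, mem_componentPart]
  constructor
  · rintro ⟨v, ⟨hC, hA⟩, rfl⟩
    exact ⟨hA, v.2, hC⟩
  · rintro ⟨hA, h, hC⟩
    exact ⟨⟨w, h⟩, ⟨hC, hA⟩, rfl⟩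

theorem filter_adj_subset_componentPart {V : Type*} {G : SimpleGraph V} [DecidableRel G.Adj]
    {s : Set V} {C : (G.induce s).ConnectedComponent} {A B : Finset V} (hB : (B : Set V) ⊆ s)
    {v : V} (hv : v ∈ componentPart C A) :
    B.filter (fun w => G.Adj v w) ⊆ componentPart C B := by
  intro w hw
  obtain ⟨hwB, hadj⟩ := Finset.mem_filter.mp hw
  obtain ⟨-, hvs, rfl⟩ := mem_componentPart.mp hv
  refine mem_componentPart.mpr ⟨hwB, hB hwB, ?_⟩
  apply SimpleGraph.ConnectedComponent.sound
  apply SimpleGraph.Adj.reachable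
  simpa using hadj.symm


/-- Suppose `T₁, …, T_m` (`m ≥ 2`) are pairwise disjoint nonempty vertex sets of
a finite simple graph `G` such that for all `i ≠ j` every vertex of `T i` has at least
`|T j|/2` neighbours in `T j`, and suppose the subgraph induced by `T₁ ∪ … ∪ T_m` is
disconnected, with (exactly two) connected components `C₁` and `C₂`.  Then each component
contains exactly half of each terminal set, and within each component the terminals from two
different sets are joined by a complete bipartite graph. -/
theorem dense_family_two_components_structure {V : Type*} [Fintype V] [DecidableEq V]
    (G : SimpleGraph V) [DecidableRel G.Adj]
    {m : ℕ} (hm : 2 ≤ m) (T : Fin m → Finset V)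
    (hdisj : ∀ i j, i ≠ j → Disjoint (T i) (T j))
    (hne : ∀ i, (T i).Nonempty)
    (hdense : ∀ i j, i ≠ j → ∀ v ∈ T i,
      ((T j).card : ℝ) / 2 ≤ (((T j).filter (fun w => G.Adj v w)).card : ℝ))
    (hdisc : ¬ (G.induce (⋃ i, ((T i : Set V)))).Connected)
    (C₁ C₂ : (G.induce (⋃ i, ((T i : Set V)))).ConnectedComponent)
    (hCne : C₁ ≠ C₂)
    (hCall : ∀ C : (G.induce (⋃ i, ((T i : Set V)))).ConnectedComponent, C = C₁ ∨ C = C₂) :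
    (∀ C : (G.induce (⋃ i, ((T i : Set V)))).ConnectedComponent, ∀ i : Fin m,
        (({v ∈ C.supp | (v : V) ∈ T i}).ncard : ℝ) = ((T i).card : ℝ) / 2) ∧
    (∀ C : (G.induce (⋃ i, ((T i : Set V)))).ConnectedComponent, ∀ i j, i ≠ j →
        ∀ u ∈ C.supp, (u : V) ∈ T i → ∀ v ∈ C.supp, (v : V) ∈ T j → G.Adj u v) := by
  have hsub : ∀ i, (T i : Set V) ⊆ ⋃ i, (T i : Set V) :=
    fun i => Set.subset_iUnion (fun i => (T i : Set V)) i
  have hstep : ∀ (C : (G.induce (⋃ i, ((T i : Set V)))).ConnectedComponent) (i j : Fin m),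
      i ≠ j → (componentPart C (T i)).Nonempty →
      ((T j).card : ℝ) / 2 ≤ ((componentPart C (T j)).card : ℝ) := by
    rintro C i j hij ⟨v, hv⟩
    refine (hdense i j hij v (mem_componentPart.mp hv).1).trans ?_
    exact_mod_cast Finset.card_le_card (filter_adj_subset_componentPart (hsub j) hv)
  have hpos : ∀ i, (0 : ℝ) < (T i).card := fun i => by exact_mod_cast (hne i).card_pos
  have hlower : ∀ (C : (G.induce (⋃ i, ((T i : Set V)))).ConnectedComponent) (i : Fin m),
      ((T i).card : ℝ) / 2 ≤ ((componentPart C (T i)).card : ℝ) := by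
    intro C i
    obtain ⟨⟨v, hvs⟩, hv⟩ := C.nonempty_supp
    obtain ⟨k, hk⟩ := Set.mem_iUnion.mp hvs
    have hkne : (componentPart C (T k)).Nonempty :=
      ⟨v, mem_componentPart.mpr ⟨hk, hvs, hv⟩⟩
    by_cases hki : k = i
    · subst hki
      have : Nontrivial (Fin m) := Fin.nontrivial_iff_two_le.mpr hm
      obtain ⟨j, hj⟩ := exists_ne k
      refine hstep C j k hj (Finset.card_pos.mp ?_)
      have := hstep C k j hj.symm hkne
      have := hpos j
      exact_mod_cast (show (0 : ℝ) < ((componentPart C (T j)).card : ℝ) by linarith)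
    · exact hstep C k i hki hkne
  have hsum : ∀ i, (componentPart C₁ (T i)).card + (componentPart C₂ (T i)).card
      ≤ (T i).card := by
    intro i
    rw [← Finset.card_union_of_disjoint]
    · refine Finset.card_le_card (Finset.union_subset ?_ ?_) <;>
        exact fun w hw => (mem_componentPart.mp hw).1
    · refine Finset.disjoint_left.mpr fun w h₁ h₂ => hCne ?_
      obtain ⟨-, _, e₁⟩ := mem_componentPart.mp h₁
      obtain ⟨-, _, e₂⟩ := mem_componentPart.mp h₂
      exact e₁.symm.trans e₂
  have hhalf : ∀ (C : (G.induce (⋃ i, ((T i : Set V)))).ConnectedComponent) (i : Fin m),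
      ((componentPart C (T i)).card : ℝ) = ((T i).card : ℝ) / 2 := by
    intro C i
    have h₁ := hlower C₁ i
    have h₂ := hlower C₂ i
    have h : ((componentPart C₁ (T i)).card : ℝ) + ((componentPart C₂ (T i)).card : ℝ)
      ≤ (T i).card := by exact_mod_cast hsum i
    rcases hCall C with rfl | rfl <;> linarith
  refine ⟨fun C i => by rw [ncard_supp_inter, hhalf], fun C i j hij u hu hui v hv hvj => ?_⟩
  have hu' : (u : V) ∈ componentPart C (T i) := mem_componentPart.mpr ⟨hui, u.2, hu⟩
  have hv' : (v : V) ∈ componentPart C (T j) := mem_componentPart.mpr ⟨hvj, v.2, hv⟩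
  have heq := Finset.eq_of_subset_of_card_le
    (filter_adj_subset_componentPart (hsub j) hu') (by
      have := hdense i j hij u hui
      rw [← hhalf C j] at this
      exact_mod_cast this)
  rw [← heq] at hv'
  exact (Finset.mem_filter.mp hv').2
end

section
/- Let G be a finite simple graph and let T₁,…,T_m (m ≥ 2) be pairwise disjoint nonempty subsets of V(G) such that for all i ≠ j, every vertex of T_i has at least |T_j|/2 neighbours in T_j. If for some i the subgraph of G induced by T_i is connected, then the subgraph of G induced by T₁ ∪ … ∪ T_m is connected. -/
/-- If `T₁, …, T_m` (`m ≥ 2`) are pairwise disjoint nonempty vertex sets of a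
finite simple graph `G` such that for all `i ≠ j` every vertex of `T i` has at least
`|T j|/2` neighbours in `T j`, and some `T i` induces a connected subgraph, then the
subgraph of `G` induced by `T₁ ∪ … ∪ T_m` is connected. -/
theorem dense_family_trivial_set_connected {V : Type*} [Fintype V] [DecidableEq V]
    (G : SimpleGraph V) [DecidableRel G.Adj]
    {m : ℕ} (hm : 2 ≤ m) (T : Fin m → Finset V)
    (hdisj : ∀ i j, i ≠ j → Disjoint (T i) (T j))
    (hne : ∀ i, (T i).Nonempty)
    (hdense : ∀ i j, i ≠ j → ∀ v ∈ T i,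
      ((T j).card : ℝ) / 2 ≤ (((T j).filter (fun w => G.Adj v w)).card : ℝ))
    (htriv : ∃ i, (G.induce ((T i : Set V))).Connected) :
    (G.induce (⋃ i, ((T i : Set V)))).Connected := by
  obtain ⟨i, hi⟩ := htriv
  have hsub : (T i : Set V) ⊆ ⋃ i, (T i : Set V) :=
    Set.subset_iUnion (fun i => (T i : Set V)) i
  obtain ⟨a, ha⟩ := hne i
  have reach_of_mem : ∀ w (hw : w ∈ T i),
      (G.induce (⋃ i, (T i : Set V))).Reachable ⟨w, hsub hw⟩ ⟨a, hsub ha⟩ := fun w hw =>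
    (hi.preconnected ⟨w, hw⟩ ⟨a, ha⟩).map (SimpleGraph.induceHomOfLE G hsub).toHom
  have reach : ∀ v, (G.induce (⋃ i, (T i : Set V))).Reachable v ⟨a, hsub ha⟩ := by
    rintro ⟨v, hv⟩
    obtain ⟨j, hj⟩ := Set.mem_iUnion.mp hv
    by_cases hji : j = i
    · subst hji
      exact reach_of_mem v hj
    · have hpos : (0 : ℝ) < (((T i).filter (fun w => G.Adj v w)).card : ℝ) := by
        have hcard : (0 : ℝ) < ((T i).card : ℝ) := by
          exact_mod_cast Finset.card_pos.mpr (hne i)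
        linarith [hdense j i hji v hj]
      obtain ⟨w, hw⟩ := Finset.card_pos.mp (Nat.cast_pos.mp hpos)
      obtain ⟨hwi, hadj⟩ := Finset.mem_filter.mp hw
      have hadj' : (G.induce (⋃ i, (T i : Set V))).Adj ⟨v, hv⟩ ⟨w, hsub hwi⟩ := hadj
      exact hadj'.reachable.trans (reach_of_mem w hwi)
  exact { preconnected := fun u v => (reach u).trans (reach v).symm
          nonempty := ⟨⟨a, hsub ha⟩⟩ }
end

section
/- Let G be a finite simple graph and let T₁,…,T_m (m ≥ 4) be pairwise disjoint nonempty subsets of V(G) such that for all i ≠ j, every vertex of T_i has at least |T_j|/2 neighbours in T_j. If the subgraph of G induced by T₁ ∪ … ∪ T_m is connected, then there exist three distinct indices i, j, ℓ ∈ {1,…,m} such that the subgraph of G induced by T_i ∪ T_j ∪ T_ℓ is connected. -/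
open Finset

namespace SimpleGraph

variable {V ι : Type*} {G : SimpleGraph V}

/-- A predicate preserved along the edges of a connected graph is constant. -/
theorem Preconnected.iff_of_forall_adj (hG : G.Preconnected) {c : V → Prop}
    (hc : ∀ x y, G.Adj x y → (c x ↔ c y)) (x y : V) : c x ↔ c y := by
  obtain ⟨w⟩ := hG x y
  induction w with
  | nil => rfl
  | cons h _ ih => exact (hc _ _ h).trans ih

/-- A nonempty induced subgraph that is not connected has a nonconstant predicate preserved
along its edges. -/
theorem exists_separation_of_not_connected_induce {S : Set V} (hS : S.Nonempty)
    (h : ¬ (G.induce S).Connected) :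
    ∃ c : V → Prop, (∀ x ∈ S, ∀ y ∈ S, G.Adj x y → (c x ↔ c y)) ∧
      (∃ x ∈ S, c x) ∧ ∃ x ∈ S, ¬ c x := by
  have hp : ¬ (G.induce S).Preconnected := fun hp =>
    h (@Connected.mk _ _ hp hS.to_subtype)
  simp only [Preconnected, not_forall] at hp
  obtain ⟨u, v, huv⟩ := hp
  refine ⟨fun x => ∃ hx : x ∈ S, (G.induce S).Reachable u ⟨x, hx⟩, ?_,
    ⟨u, u.2, u.2, Reachable.refl _⟩, v, v.2, fun ⟨_, hv⟩ => huv hv⟩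
  intro x hx y hy hxy
  have hadj : (G.induce S).Adj ⟨x, hx⟩ ⟨y, hy⟩ := hxy
  exact ⟨fun ⟨_, r⟩ => ⟨hy, r.trans hadj.reachable⟩,
    fun ⟨_, r⟩ => ⟨hx, r.trans hadj.symm.reachable⟩⟩

/-- If every vertex of each part is adjacent to at least half of every other part, then a
separation of a union of parts meets every part on both sides, and two vertices in
different parts are adjacent whenever they lie on the same side. -/
theorem separation_of_half_dense [DecidableRel G.Adj] {T : ι → Finset V} {s : Set ι}
    (hdense : ∀ i j, i ≠ j → ∀ v ∈ T i, #(T j) ≤ 2 * #{w ∈ T j | G.Adj v w})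
    (hne : ∀ i, (T i).Nonempty) {c : V → Prop}
    (hc : ∀ p ∈ s, ∀ q ∈ s, ∀ x ∈ T p, ∀ y ∈ T q, G.Adj x y → (c x ↔ c y))
    (hpos : ∃ p ∈ s, ∃ x ∈ T p, c x) (hneg : ∃ p ∈ s, ∃ x ∈ T p, ¬ c x) :
    (∀ p ∈ s, (∃ x ∈ T p, c x) ∧ ∃ x ∈ T p, ¬ c x) ∧
      ∀ p ∈ s, ∀ q ∈ s, p ≠ q → ∀ x ∈ T p, ∀ y ∈ T q, (c x ↔ c y) → G.Adj x y := by
  classical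
  have hnbr : ∀ p ∈ s, ∀ q ∈ s, p ≠ q → ∀ x ∈ T p, ∃ y ∈ T q, (c x ↔ c y) := by
    intro p hp q hq hpq x hx
    have h1 := hdense p q hpq x hx
    have h2 := (hne q).card_pos
    obtain ⟨y, hy⟩ : Finset.Nonempty {w ∈ T q | G.Adj x w} := card_pos.mp (by omega)
    rw [mem_filter] at hy
    exact ⟨y, hy.1, hc p hp q hq x hx y hy.1 hy.2⟩
  have hmeet : ∀ p ∈ s, (∃ x ∈ T p, c x) ∧ ∃ x ∈ T p, ¬ c x := by
    intro q hq
    constructor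
    · obtain ⟨p, hp, x, hx, hcx⟩ := hpos
      by_cases hpq : p = q
      · exact ⟨x, hpq ▸ hx, hcx⟩
      · obtain ⟨y, hy, hxy⟩ := hnbr p hp q hq hpq x hx
        exact ⟨y, hy, hxy.mp hcx⟩
    · obtain ⟨p, hp, x, hx, hcx⟩ := hneg
      by_cases hpq : p = q
      · exact ⟨x, hpq ▸ hx, hcx⟩
      · obtain ⟨y, hy, hxy⟩ := hnbr p hp q hq hpq x hx
        exact ⟨y, hy, fun hcy => hcx (hxy.mpr hcy)⟩
  refine ⟨hmeet, fun p hp q hq hpq x hx y hy hxy => ?_⟩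
  have hsub : ∀ z ∈ T p, {w ∈ T q | G.Adj z w} ⊆ {w ∈ T q | c z ↔ c w} := fun z hz w hw => by
    rw [mem_filter] at hw ⊢
    exact ⟨hw.1, hc p hp q hq z hz w hw.1 hw.2⟩
  -- a vertex on the opposite side shows that the side of `x` has at most half of `T q`
  obtain ⟨z, hz, hxz⟩ : ∃ z ∈ T p, ¬ (c x ↔ c z) := by
    obtain ⟨⟨u, hu, hcu⟩, v, hv, hcv⟩ := hmeet p hp
    by_cases hcx : c x
    · exact ⟨v, hv, by tauto⟩
    · exact ⟨u, hu, by tauto⟩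
  have hcompl : ({w ∈ T q | c z ↔ c w} : Finset V) = {w ∈ T q | ¬ (c x ↔ c w)} :=
    filter_congr fun w _ => by tauto
  have h1 := card_le_card (hsub z hz)
  have h2 := hdense p q hpq z hz
  have h3 := hdense p q hpq x hx
  have h4 := card_filter_add_card_filter_not (s := T q) (fun w => c x ↔ c w)
  rw [hcompl] at h1
  have heq := eq_of_subset_of_card_le (hsub x hx) (by omega)
  have hmem : y ∈ ({w ∈ T q | c x ↔ c w} : Finset V) := mem_filter.mpr ⟨hy, hxy⟩
  rw [← heq] at hmem
  exact (mem_filter.mp hmem).2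

end SimpleGraph


/-- If `T₁, …, T_m` (`m ≥ 4`) are pairwise disjoint nonempty vertex sets of a
finite simple graph `G` such that for all `i ≠ j` every vertex of `T i` has at least
`|T j|/2` neighbours in `T j`, and the subgraph induced by `T₁ ∪ … ∪ T_m` is connected,
then there are three distinct indices `i, j, ℓ` such that the subgraph induced by
`T i ∪ T j ∪ T ℓ` is connected (a "triplet"). -/
theorem dense_family_contains_triplet {V : Type*} [Fintype V] [DecidableEq V]
    (G : SimpleGraph V) [DecidableRel G.Adj]
    {m : ℕ} (hm : 4 ≤ m) (T : Fin m → Finset V)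
    (hdisj : ∀ i j, i ≠ j → Disjoint (T i) (T j))
    (hne : ∀ i, (T i).Nonempty)
    (hdense : ∀ i j, i ≠ j → ∀ v ∈ T i,
      ((T j).card : ℝ) / 2 ≤ (((T j).filter (fun w => G.Adj v w)).card : ℝ))
    (hconn : (G.induce (⋃ i, ((T i : Set V)))).Connected) :
    ∃ i j ℓ : Fin m, i ≠ j ∧ i ≠ ℓ ∧ j ≠ ℓ ∧
      (G.induce (((T i : Set V)) ∪ (T j : Set V) ∪ (T ℓ : Set V))).Connected := by
  have hdense' : ∀ i j, i ≠ j → ∀ v ∈ T i, #(T j) ≤ 2 * #{w ∈ T j | G.Adj v w} := by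
    intro i j hij v hv
    have h := hdense i j hij v hv
    have h' : ((T j).card : ℝ) ≤ 2 * (((T j).filter (fun w => G.Adj v w)).card : ℝ) := by
      linarith
    exact_mod_cast h'
  by_contra hcon
  have hsep : ∀ i j k : Fin m, i ≠ j → i ≠ k → j ≠ k → ∃ c : V → Prop,
      (∀ p ∈ ({i, j, k} : Set (Fin m)), ∀ q ∈ ({i, j, k} : Set (Fin m)),
        ∀ x ∈ T p, ∀ y ∈ T q, (G.Adj x y → (c x ↔ c y)) ∧ (p ≠ q → (c x ↔ c y) → G.Adj x y)) ∧
      ∀ p ∈ ({i, j, k} : Set (Fin m)), (∃ x ∈ T p, c x) ∧ ∃ x ∈ T p, ¬ c x := by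
    intro i j k hij hik hjk
    have hmem : ∀ x, x ∈ ((T i : Set V) ∪ (T j : Set V) ∪ (T k : Set V)) ↔
        ∃ p ∈ ({i, j, k} : Set (Fin m)), x ∈ T p := by
      simp [or_assoc]
    obtain ⟨u, hu⟩ := hne i
    obtain ⟨c, hc, ⟨x, hx, hcx⟩, y, hy, hcy⟩ :=
      SimpleGraph.exists_separation_of_not_connected_induce (G := G)
        ⟨u, (hmem u).mpr ⟨i, by simp, hu⟩⟩ (fun h => hcon ⟨i, j, k, hij, hik, hjk, h⟩)
    obtain ⟨p, hp, hxp⟩ := (hmem x).mp hx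
    obtain ⟨q, hq, hyq⟩ := (hmem y).mp hy
    have hadj : ∀ p ∈ ({i, j, k} : Set (Fin m)), ∀ q ∈ ({i, j, k} : Set (Fin m)),
        ∀ x ∈ T p, ∀ y ∈ T q, G.Adj x y → (c x ↔ c y) := fun p hp q hq x hx y hy =>
      hc x ((hmem x).mpr ⟨p, hp, hx⟩) y ((hmem y).mpr ⟨q, hq, hy⟩)
    obtain ⟨hmeet, hsame⟩ := SimpleGraph.separation_of_half_dense
      hdense' hne hadj ⟨p, hp, x, hxp, hcx⟩ ⟨q, hq, y, hyq, hcy⟩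
    exact ⟨c, fun p hp q hq x hx y hy =>
      ⟨hadj p hp q hq x hx y hy, fun hpq => hsame p hp q hq hpq x hx y hy⟩, hmeet⟩
  obtain ⟨o, e, f, hoe, hof, hef⟩ : ∃ o e f : Fin m, o ≠ e ∧ o ≠ f ∧ e ≠ f :=
    ⟨⟨0, by omega⟩, ⟨1, by omega⟩, ⟨2, by omega⟩, by simp, by simp, by simp⟩
  obtain ⟨a, ha⟩ := hne o
  obtain ⟨b, hb, hab⟩ : ∃ b ∈ T e, G.Adj a b := by
    have h1 := hdense' o e hoe a ha
    have h2 := (hne e).card_pos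
    obtain ⟨y, hy⟩ : Finset.Nonempty {w ∈ T e | G.Adj a w} := card_pos.mp (by omega)
    exact ⟨y, (mem_filter.mp hy).1, (mem_filter.mp hy).2⟩
  obtain ⟨b', hb', hab'⟩ : ∃ b' ∈ T e, ¬ G.Adj a b' := by
    obtain ⟨c, hc, hmeet⟩ := hsep o e f hoe hof hef
    obtain ⟨⟨u, hu, hcu⟩, v, hv, hcv⟩ := hmeet e (by simp)
    have h1 := (hc o (by simp) e (by simp) a ha u hu).1
    have h2 := (hc o (by simp) e (by simp) a ha v hv).1
    by_cases hca : c a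
    · exact ⟨v, hv, by tauto⟩
    · exact ⟨u, hu, by tauto⟩
  have hnot : ∀ p, p ≠ o → ∀ x ∈ T p, x ∉ T o := fun p hp x hx hx' =>
    (disjoint_left.mp (hdisj p o hp)) hx hx'
  let d : V → Prop := fun x => if x ∈ T o then G.Adj x b else G.Adj a x
  have hdo : ∀ x ∈ T o, (d x ↔ G.Adj x b) := fun x hx => by simp [d, hx]
  have hdn : ∀ p, p ≠ o → ∀ x ∈ T p, (d x ↔ G.Adj a x) := fun p hp x hx => by
    simp [d, hnot p hp x hx]
  have hcol : ∀ j k, o ≠ j → o ≠ k → j ≠ k → ∃ c : V → Prop,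
      (∀ p ∈ ({o, j, k} : Set (Fin m)), ∀ q ∈ ({o, j, k} : Set (Fin m)),
        ∀ x ∈ T p, ∀ y ∈ T q, G.Adj x y → (c x ↔ c y)) ∧
      (∀ p ∈ ({o, j, k} : Set (Fin m)), p ≠ o → ∀ x ∈ T p, (d x ↔ (c a ↔ c x))) ∧
      (e ∈ ({o, j, k} : Set (Fin m)) → ∀ x ∈ T o, (d x ↔ (c a ↔ c x))) := by
    intro j k hj hk hjk
    obtain ⟨c, hc, -⟩ := hsep o j k hj hk hjk
    refine ⟨c, fun p hp q hq x hx y hy => (hc p hp q hq x hx y hy).1, ?_, ?_⟩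
    · intro p hp hpo x hx
      have h := hc o (by simp) p hp a ha x hx
      rw [hdn p hpo x hx]
      exact ⟨h.1, h.2 hpo.symm⟩
    · intro he x hx
      have h := hc o (by simp) e he x hx b hb
      have h' := (hc o (by simp) e he a ha b hb).1 hab
      rw [hdo x hx, h']
      exact ⟨fun hxb => (h.1 hxb).symm, fun hcx => h.2 hoe hcx.symm⟩
  have hroot : ∀ x ∈ T o, ∀ q, ∀ y ∈ T q, G.Adj x y → (d x ↔ d y) := by
    intro x hx q y hy hxy
    obtain ⟨k, hok, hek, hq⟩ : ∃ k, o ≠ k ∧ e ≠ k ∧ q ∈ ({o, e, k} : Set (Fin m)) := by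
      by_cases hqo : q = o
      · exact ⟨f, hof, hef, by simp [hqo]⟩
      by_cases hqe : q = e
      · exact ⟨f, hof, hef, by simp [hqe]⟩
      exact ⟨q, Ne.symm hqo, Ne.symm hqe, by simp⟩
    obtain ⟨c, hc, hd, hd'⟩ := hcol e k hoe hok hek
    rw [hd' (by simp) x hx, hc o (by simp) q hq x hx y hy hxy]
    by_cases hqo : q = o
    · subst hqo
      rw [hd' (by simp) y hy]
    · rw [hd q hq hqo y hy]
  have hdadj : ∀ p q, ∀ x ∈ T p, ∀ y ∈ T q, G.Adj x y → (d x ↔ d y) := by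
    intro p q x hx y hy hxy
    by_cases hpo : p = o
    · exact hroot x (hpo ▸ hx) q y hy hxy
    by_cases hqo : q = o
    · exact (hroot y (hqo ▸ hy) p x hx hxy.symm).symm
    obtain ⟨k, hok, hpk, hq⟩ : ∃ k, o ≠ k ∧ p ≠ k ∧ q ∈ ({o, p, k} : Set (Fin m)) := by
      by_cases hqp : q = p
      · by_cases hpe : p = e
        · exact ⟨f, hof, hpe ▸ hef, by simp [hqp]⟩
        · exact ⟨e, hoe, hpe, by simp [hqp]⟩
      · exact ⟨q, Ne.symm hqo, Ne.symm hqp, by simp⟩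
    obtain ⟨c, hc, hd, -⟩ := hcol p k (Ne.symm hpo) hok hpk
    rw [hd p (by simp) hpo x hx, hd q hq hqo y hy, hc p (by simp) q hq x hx y hy hxy]
  have hU : ∀ p, ∀ x ∈ T p, x ∈ ⋃ i, (T i : Set V) := fun p x hx =>
    Set.mem_iUnion.mpr ⟨p, hx⟩
  have hconst := hconn.preconnected.iff_of_forall_adj (c := fun x => d x)
    (fun x y hxy => by
      obtain ⟨p, hp⟩ := Set.mem_iUnion.mp x.2
      obtain ⟨q, hq⟩ := Set.mem_iUnion.mp y.2
      exact hdadj p q x hp y hq hxy)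
    ⟨b, hU e b hb⟩ ⟨b', hU e b' hb'⟩
  exact hab' ((hdn e hoe.symm b' hb').mp (hconst.mp ((hdn e hoe.symm b hb).mpr hab)))
end

section
/- Let δ > 0, let G be a finite simple graph, let T₁,…,T_k be pairwise disjoint nonempty subsets of V(G), and let S = V(G) \ (T₁ ∪ … ∪ T_k). Suppose that for all i ≠ j, every vertex t ∈ T_i has at least δ·|T_j| neighbours in T_j and at least δ·|S| neighbours in S, and suppose that at least one Steiner forest for (G; T₁,…,T_k) exists. Then there exists a minimum Steiner forest F⋆ such that either F⋆ has at most one connected component, or F⋆ contains no vertex of S. -/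
/-- A Steiner forest for `(G; T₁, …, T_k)`: a subgraph of `G` that is a forest (acyclic) in
which, for each `i`, all vertices of `T i` lie in the same connected component. -/
def IsSteinerForest {V : Type*} (G : SimpleGraph V) {k : ℕ} (T : Fin k → Finset V)
    (F : SimpleGraph V) : Prop :=
  F ≤ G ∧ F.IsAcyclic ∧ ∀ i : Fin k, ∀ u ∈ T i, ∀ v ∈ T i, F.Reachable u v

namespace SimpleGraph

variable {V : Type*} {F : SimpleGraph V}

/-- The graph `F` with all edges of the connected component `C` removed. -/
def ConnectedComponent.outside (C : F.ConnectedComponent) : SimpleGraph V where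
  Adj a b := F.Adj a b ∧ a ∉ C.supp ∧ b ∉ C.supp
  symm := ⟨fun _ _ h => ⟨h.1.symm, h.2.2, h.2.1⟩⟩
  loopless := ⟨fun _ h => h.1.ne rfl⟩

namespace ConnectedComponent

variable (C : F.ConnectedComponent)

lemma outside_le : C.outside ≤ F := fun _ _ h => h.1

lemma mem_supp_of_reachable {a b : V} (h : F.Reachable a b) (hb : b ∈ C.supp) : a ∈ C.supp := by
  rw [mem_supp_iff] at hb ⊢
  rw [← hb, ConnectedComponent.eq]
  exact h

lemma reachable_outside {a b : V} (h : F.Reachable a b) (ha : a ∉ C.supp) :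
    C.outside.Reachable a b := by
  obtain ⟨p⟩ := h
  induction p with
  | nil => exact Reachable.refl _
  | cons hadj _ ih =>
    have hv := fun hv => ha (C.mem_supp_of_reachable hadj.reachable hv)
    exact (Adj.reachable (G := C.outside) ⟨hadj, ha, hv⟩).trans (ih hv)

lemma ncard_edgeSet_outside_add_ncard_supp_le [Finite V] :
    C.outside.edgeSet.ncard + C.supp.ncard ≤ F.edgeSet.ncard + 1 := by
  have hcard := C.connected_toSimpleGraph.card_vert_le_card_edgeSet_add_one
  have hinj : (Sym2.map (Subtype.val : C → V)).Injective :=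
    Sym2.map.injective Subtype.val_injective
  have hsub : Sym2.map (Subtype.val : C → V) '' C.toSimpleGraph.edgeSet ⊆ F.edgeSet := by
    rintro _ ⟨e, he, rfl⟩
    induction e with
    | _ a b => exact he
  have hdisj : Disjoint C.outside.edgeSet
      (Sym2.map (Subtype.val : C → V) '' C.toSimpleGraph.edgeSet) := by
    rw [Set.disjoint_left]
    rintro _ he ⟨e, -, rfl⟩
    induction e with
    | _ a b => exact he.2.1 a.2
  have hunion := Set.ncard_union_eq hdisj (Set.toFinite _) (Set.toFinite _)
  have hle := Set.ncard_le_ncard (Set.union_subset (edgeSet_mono C.outside_le) hsub)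
    (Set.toFinite _)
  rw [Set.ncard_image_of_injective _ hinj] at hunion
  have hsupp : Nat.card C = C.supp.ncard := rfl
  rw [Nat.card_coe_set_eq] at hcard
  omega

end ConnectedComponent

end SimpleGraph

open SimpleGraph

/-- A subgraph of `G` connecting every terminal set contains a Steiner forest. -/
lemma exists_isSteinerForest_le {V : Type*} {G H : SimpleGraph V} {k : ℕ} {T : Fin k → Finset V}
    (hle : H ≤ G) (hreach : ∀ i, ∀ u ∈ T i, ∀ v ∈ T i, H.Reachable u v) :
    ∃ F ≤ H, IsSteinerForest G T F := by
  obtain ⟨F, hFH, hF, hr⟩ := H.exists_isAcyclic_reachable_eq_le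
  exact ⟨F, hFH, hFH.trans hle, hF, fun i u hu v hv => hr ▸ hreach i u hu v hv⟩

/-- In a minimum Steiner forest every component that is not an isolated vertex has a terminal. -/
lemma exists_terminal_reachable_of_mem_support {V : Type*} [Finite V] {G F : SimpleGraph V} {k : ℕ}
    {T : Fin k → Finset V} (hF : IsSteinerForest G T F)
    (hmin : ∀ F', IsSteinerForest G T F' → F.edgeSet.ncard ≤ F'.edgeSet.ncard)
    {w : V} (hw : w ∈ F.support) : ∃ i, ∃ t ∈ T i, F.Reachable t w := by
  by_contra! h
  let C := F.connectedComponentMk w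
  obtain ⟨x, hx⟩ := hw
  obtain ⟨F', hF'C, hF'⟩ := exists_isSteinerForest_le (T := T) (C.outside_le.trans hF.1)
    fun i u hu v hv => C.reachable_outside (hF.2.2 i u hu v hv)
      fun huC => h i u hu (ConnectedComponent.exact huC)
  have hedges := C.ncard_edgeSet_outside_add_ncard_supp_le
  have hle := (hmin F' hF').trans (Set.ncard_le_ncard (edgeSet_mono hF'C) (Set.toFinite _))
  have htwo : 1 < C.supp.ncard := by
    rw [Set.one_lt_ncard (Set.toFinite _)]
    exact ⟨w, rfl, x, ConnectedComponent.sound hx.symm.reachable, hx.ne⟩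
  omega

/-- If a component of a Steiner forest contains a nonterminal `s`, then attaching its terminals
directly to a terminal set in another component gives a Steiner forest with no more edges that
avoids `s` and uses no new nonterminal. -/
lemma exists_isSteinerForest_avoiding {V : Type*} [Finite V] {G F : SimpleGraph V} {k : ℕ}
    {T : Fin k → Finset V} (hF : IsSteinerForest G T F)
    (hadj : ∀ i j, i ≠ j → ∀ t ∈ T i, ∃ w ∈ T j, G.Adj t w)
    {s : V} (hs : ∀ i, s ∉ T i) {j : Fin k} {t : V} (ht : t ∈ T j) (hts : ¬ F.Reachable t s) :
    ∃ F', IsSteinerForest G T F' ∧ F'.edgeSet.ncard ≤ F.edgeSet.ncard ∧ s ∉ F'.support ∧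
      ∀ x ∈ F'.support, (∀ i, x ∉ T i) → x ∈ F.support := by
  let C := F.connectedComponentMk s
  let A : Set V := {a | a ∈ C.supp ∧ ∃ i, a ∈ T i}
  have hsC : s ∈ C.supp := rfl
  have hout : ∀ w ∈ T j, w ∉ C.supp := fun w hw hwC =>
    hts ((hF.2.2 j t ht w hw).trans (ConnectedComponent.exact hwC))
  have hnbr : ∀ a, ∃ b, a ∈ A → b ∈ T j ∧ G.Adj a b := by
    intro a
    by_cases ha : a ∈ A
    · obtain ⟨haC, i, hi⟩ := ha
      obtain ⟨b, hb⟩ := hadj i j (fun hij => hout a (hij ▸ hi) haC) a hi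
      exact ⟨b, fun _ => hb⟩
    · exact ⟨a, fun h => absurd h ha⟩
  choose f hf using hnbr
  let E : Set (Sym2 V) := (fun a => s(a, f a)) '' A
  let H : SimpleGraph V := C.outside ⊔ fromEdgeSet E
  have hHadj : ∀ a b, H.Adj a b → C.outside.Adj a b ∨ a ∈ A ∧ b = f a ∨ b ∈ A ∧ a = f b := by
    rintro a b (h | h)
    · exact Or.inl h
    · obtain ⟨⟨c, hc, hcab⟩, -⟩ := (fromEdgeSet_adj _).1 h
      rcases Sym2.eq_iff.1 hcab with ⟨rfl, rfl⟩ | ⟨rfl, rfl⟩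
      · exact Or.inr (Or.inl ⟨hc, rfl⟩)
      · exact Or.inr (Or.inr ⟨hc, rfl⟩)
  have hHG : H ≤ G := by
    intro a b hab
    rcases hHadj a b hab with h | ⟨ha, rfl⟩ | ⟨hb, rfl⟩
    · exact hF.1 h.1
    · exact (hf a ha).2
    · exact (hf b hb).2.symm
  have hHf : ∀ a ∈ A, H.Reachable a (f a) := fun a ha =>
    Adj.reachable (Or.inr ((fromEdgeSet_adj _).2 ⟨⟨a, ha, rfl⟩, (hf a ha).2.ne⟩))
  have hHout : ∀ {a b}, F.Reachable a b → a ∉ C.supp → H.Reachable a b := fun h ha =>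
    (C.reachable_outside h ha).mono le_sup_left
  have hreach : ∀ i, ∀ u ∈ T i, ∀ v ∈ T i, H.Reachable u v := by
    intro i u hu v hv
    have huv := hF.2.2 i u hu v hv
    by_cases huC : u ∈ C.supp
    · have huA : u ∈ A := ⟨huC, i, hu⟩
      have hvA : v ∈ A := ⟨C.mem_supp_of_reachable huv.symm huC, i, hv⟩
      have hfu := (hf u huA).1
      exact ((hHf u huA).trans (hHout (hF.2.2 j _ hfu _ (hf v hvA).1) (hout _ hfu))).trans
        (hHf v hvA).symm
    · exact hHout huv huC
  have hcard : H.edgeSet.ncard ≤ F.edgeSet.ncard := by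
    have hsub : H.edgeSet ⊆ C.outside.edgeSet ∪ E := by
      rw [edgeSet_sup, edgeSet_fromEdgeSet]
      exact Set.union_subset_union_right _ Set.sdiff_subset
    have hle := (Set.ncard_le_ncard hsub (Set.toFinite _)).trans (Set.ncard_union_le _ _)
    have hE : E.ncard ≤ A.ncard := Set.ncard_image_le (Set.toFinite _)
    have hA : A.ncard < C.supp.ncard := by
      refine Set.ncard_lt_ncard ⟨fun a ha => ha.1, fun h => ?_⟩ (Set.toFinite _)
      obtain ⟨-, i, hi⟩ := h hsC
      exact hs i hi
    have hedges := C.ncard_edgeSet_outside_add_ncard_supp_le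
    omega
  have hsupp : ∀ x y, H.Adj x y → (∀ i, x ∉ T i) → C.outside.Adj x y := by
    intro x y hxy hx
    rcases hHadj x y hxy with h | ⟨⟨-, i, hi⟩, -⟩ | ⟨hy, rfl⟩
    · exact h
    · exact absurd hi (hx i)
    · exact absurd (hf y hy).1 (hx j)
  obtain ⟨F', hF'H, hF'⟩ := exists_isSteinerForest_le hHG hreach
  refine ⟨F', hF', (Set.ncard_le_ncard (edgeSet_mono hF'H) (Set.toFinite _)).trans hcard, ?_, ?_⟩
  · rintro ⟨y, hy⟩
    exact (hsupp s y (hF'H hy) hs).2.1 hsC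
  · rintro x ⟨y, hy⟩ hx
    exact ⟨y, (hsupp x y (hF'H hy) hx).1⟩

/-- For `δ > 0` and a pairwise `δ`-dense instance `(G; T₁, …, T_k)` of Steiner
forest (every terminal of `T i` has at least `δ·|T j|` neighbours in each other `T j` and at
least `δ·|S|` neighbours among the Steiner nodes `S = V(G) \ (T₁ ∪ … ∪ T_k)`), if some
Steiner forest exists, then there is a minimum Steiner forest `F⋆` that either has at most
one connected component (all vertices it touches and all terminals are mutually reachable)
or uses no Steiner node. -/
theorem dense_steiner_forest_structure {V : Type*} [Fintype V] [DecidableEq V]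
    (G : SimpleGraph V) [DecidableRel G.Adj]
    {k : ℕ} (T : Fin k → Finset V) (δ : ℝ) (hδ : 0 < δ)
    (hdisj : ∀ i j, i ≠ j → Disjoint (T i) (T j))
    (hne : ∀ i, (T i).Nonempty)
    (S : Finset V) (hS : S = Finset.univ \ Finset.univ.biUnion T)
    (hdense : ∀ i j, i ≠ j → ∀ t ∈ T i,
      δ * ((T j).card : ℝ) ≤ (((T j).filter (fun w => G.Adj t w)).card : ℝ) ∧
      δ * (S.card : ℝ) ≤ ((S.filter (fun w => G.Adj t w)).card : ℝ))
    (hex : ∃ F, IsSteinerForest G T F) :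
    ∃ F : SimpleGraph V, IsSteinerForest G T F ∧
      (∀ F' : SimpleGraph V, IsSteinerForest G T F' → F.edgeSet.ncard ≤ F'.edgeSet.ncard) ∧
      ((∀ u v : V, (u ∈ F.support ∨ ∃ i, u ∈ T i) → (v ∈ F.support ∨ ∃ i, v ∈ T i) →
          F.Reachable u v) ∨
        (∀ v ∈ S, v ∉ F.support)) := by
  have hmem : ∀ v, v ∈ S ↔ ∀ i, v ∉ T i := by simp [hS]
  have hadj : ∀ i j, i ≠ j → ∀ t ∈ T i, ∃ w ∈ T j, G.Adj t w := by
    intro i j hij t ht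
    have hpos : (0 : ℝ) < (T j).card := Nat.cast_pos.2 (hne j).card_pos
    have hcard := (mul_pos hδ hpos).trans_le (hdense i j hij t ht).1
    obtain ⟨w, hw⟩ := Finset.card_pos.1 (Nat.cast_pos.1 hcard)
    exact ⟨w, Finset.mem_filter.1 hw⟩
  obtain ⟨F₀, hF₀, hF₀min⟩ := Set.exists_min_image {F | IsSteinerForest G T F}
    (fun F => F.edgeSet.ncard) (Set.toFinite _) hex
  obtain ⟨F, ⟨hF, hFmin⟩, hFS⟩ := Set.exists_min_image
    {F | IsSteinerForest G T F ∧
      ∀ F', IsSteinerForest G T F' → F.edgeSet.ncard ≤ F'.edgeSet.ncard}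
    (fun F => {x | x ∈ S ∧ x ∈ F.support}.ncard) (Set.toFinite _) ⟨F₀, hF₀, hF₀min⟩
  refine ⟨F, hF, hFmin, ?_⟩
  by_contra! h
  obtain ⟨⟨u, v, hu, hv, huv⟩, s, hsS, hsF⟩ := h
  obtain ⟨w, hw, hws⟩ : ∃ w, (w ∈ F.support ∨ ∃ i, w ∈ T i) ∧ ¬ F.Reachable w s := by
    by_cases hus : F.Reachable u s
    · exact ⟨v, hv, fun hvs => huv (hus.trans hvs.symm)⟩
    · exact ⟨u, hu, hus⟩
  obtain ⟨j, t, ht, htw⟩ : ∃ j, ∃ t ∈ T j, F.Reachable t w := by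
    rcases hw with hw | ⟨j, hj⟩
    · exact exists_terminal_reachable_of_mem_support hF hFmin hw
    · exact ⟨j, w, hj, Reachable.refl w⟩
  obtain ⟨F', hF', hcard, hsF', hsub⟩ := exists_isSteinerForest_avoiding hF hadj
    ((hmem s).1 hsS) ht fun hts => hws (htw.symm.trans hts)
  refine (hFS F' ⟨hF', fun F'' hF'' => hcard.trans (hFmin F'' hF'')⟩).not_gt
    (Set.ncard_lt_ncard ⟨fun x hx => ⟨hx.1, hsub x hx.2 ((hmem x).1 hx.1)⟩, fun hss => ?_⟩
      (Set.toFinite _))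
  exact hsF' (hss ⟨hsS, hsF⟩).2
end

section
/- Let G be a finite simple graph and let T₁,…,T_k (k ≥ 1) be pairwise disjoint nonempty subsets of V(G) with T₁ ∪ … ∪ T_k = V(G), such that for all i ≠ j, every vertex of T_i has strictly more than |T_j|/2 neighbours in T_j. Let t be the number of trivial terminal sets among T₁,…,T_k, and assume it is not the case that k = 1 and T₁ is non-trivial. Then the minimum size of a Steiner forest for (G; T₁,…,T_k) equals |V(G)| − t − ⌊(k − t)/2⌋. -/
namespace SimpleGraph

/-- In a finite forest, the number of edges plus the number of components is the number of
vertices. -/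
theorem IsAcyclic.ncard_edgeSet_add_card_connectedComponent {V : Type*} [Fintype V]
    {F : SimpleGraph V} (hF : F.IsAcyclic) :
    F.edgeSet.ncard + Nat.card F.ConnectedComponent = Fintype.card V := by
  classical
  have hcomp (c : F.ConnectedComponent) :
      ∑ v : {v // F.connectedComponentMk v = c}, F.degree v + 2 =
        2 * Fintype.card {v // F.connectedComponentMk v = c} := by
    have htree : (F.induce {v | F.connectedComponentMk v = c}).IsTree :=
      hF.isTree_connectedComponent c
    have hcard := htree.card_edgeFinset
    have hsum := (F.induce {v | F.connectedComponentMk v = c}).sum_degrees_eq_twice_card_edges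
    have hdeg (v : {v | F.connectedComponentMk v = c}) :
        (F.induce {v | F.connectedComponentMk v = c}).degree v = F.degree v := by
      refine degree_induce_of_neighborSet_subset fun w hw => ?_
      exact c.mem_supp_of_adj_mem_supp v.2 hw
    simp only [hdeg] at hsum
    change ∑ v : {v | F.connectedComponentMk v = c}, F.degree v + 2 =
        2 * Fintype.card {v | F.connectedComponentMk v = c}
    rw [← hcard]
    rw [hsum]
    ring
  have hdeg := Fintype.sum_fiberwise F.connectedComponentMk fun v => F.degree v
  have hone := Fintype.sum_fiberwise F.connectedComponentMk fun _ => 1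
  have htotal := Finset.sum_congr (rfl : (Finset.univ : Finset F.ConnectedComponent) = _)
    fun c _ => hcomp c
  rw [Finset.sum_add_distrib, hdeg, sum_degrees_eq_twice_card_edges, ← Finset.mul_sum] at htotal
  simp only [Finset.sum_const, Finset.card_univ, smul_eq_mul, mul_one] at htotal hone
  rw [Set.ncard_eq_toFinset_card', Nat.card_eq_fintype_card]
  change F.edgeFinset.card + _ = _
  lia

/-- If a partition of the vertices is constant on edges, the graph has at least as many
components as the partition has parts. -/
theorem card_image_le_card_connectedComponent {V α : Type*} [Fintype V] [DecidableEq α]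
    {H : SimpleGraph V} (f : V → α) (hf : ∀ u v, H.Adj u v → f u = f v) :
    (Finset.univ.image f).card ≤ Nat.card H.ConnectedComponent := by
  classical
  have hwalk (u v : V) (p : H.Walk u v) : f u = f v := by
    induction p with
    | nil => rfl
    | cons h _ ih => exact (hf _ _ h).trans ih
  let g : H.ConnectedComponent → α := ConnectedComponent.lift f fun u v p _ => hwalk u v p
  rw [Nat.card_eq_fintype_card, ← Finset.card_univ]
  refine (Finset.card_le_card fun a ha => ?_).trans (Finset.card_image_le (f := g))
  obtain ⟨v, -, rfl⟩ := Finset.mem_image.1 ha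
  exact Finset.mem_image.2 ⟨H.connectedComponentMk v, Finset.mem_univ _, rfl⟩

end SimpleGraph

/-- If every element that is alone in its fibre satisfies `p`, then twice the number of fibres of a
surjection is at most the number of elements plus the number of elements satisfying `p`. -/
theorem two_mul_card_le_of_surjective {ι κ : Type*} [Fintype ι] [Fintype κ]
    (p : ι → Prop) [DecidablePred p] (f : ι → κ) (hf : Function.Surjective f)
    (hp : ∀ i, (∀ j, f j = f i → j = i) → p i) :
    2 * Fintype.card κ ≤ Fintype.card ι + (Finset.univ.filter p).card := by
  classical
  have hall := Finset.card_eq_sum_card_fiberwise (f := f) (s := Finset.univ) (t := Finset.univ)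
    fun _ _ => Finset.mem_coe.2 (Finset.mem_univ _)
  have hgood := Finset.card_eq_sum_card_fiberwise (f := f) (s := Finset.univ.filter p)
    (t := Finset.univ) fun _ _ => Finset.mem_coe.2 (Finset.mem_univ _)
  rw [← Finset.card_univ, ← Finset.card_univ, hall, hgood, ← Finset.sum_add_distrib, mul_comm,
    ← smul_eq_mul]
  refine Finset.card_nsmul_le_sum _ _ _ fun c _ => ?_
  obtain ⟨i, rfl⟩ := hf c
  have hi : i ∈ Finset.univ.filter (fun j => f j = f i) := by simp
  by_cases h : ∀ j, f j = f i → j = i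
  · have hi' : i ∈ (Finset.univ.filter p).filter (fun j => f j = f i) := by simp [hp i h]
    have h1 := Finset.card_pos.2 ⟨i, hi⟩
    have h2 := Finset.card_pos.2 ⟨i, hi'⟩
    lia
  · push Not at h
    obtain ⟨j, hj, hji⟩ := h
    have : 1 < (Finset.univ.filter (fun j => f j = f i)).card :=
      Finset.one_lt_card.2 ⟨j, by simp [hj], i, hi, hji⟩
    lia

/-- A type that is not a single element failing `p` can be grouped into at least
`t + ⌊m / 2⌋` classes, where `t` elements satisfy `p` and `m` do not, so that every element
failing `p` shares its class with another element. -/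
theorem exists_grouping {ι : Type*} [Fintype ι] [DecidableEq ι] (p : ι → Prop) [DecidablePred p]
    (h : ¬ (Fintype.card ι = 1 ∧ ∃ i, ¬ p i)) :
    ∃ f : ι → ι ⊕ ℕ, (∀ i, p i ∨ ∃ j, j ≠ i ∧ f j = f i) ∧
      (Finset.univ.filter p).card + Fintype.card {i // ¬ p i} / 2 ≤
        (Finset.univ.image f).card := by
  obtain hm | hm := Nat.lt_or_ge (Fintype.card {i // ¬ p i}) 2
  · have hkey : ∃ f : ι → ι ⊕ ℕ, (∀ i, p i ∨ ∃ j, j ≠ i ∧ f j = f i) ∧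
        ∀ i, p i → f i = Sum.inl i := by
      by_cases hall : ∀ i, p i
      · exact ⟨Sum.inl, fun i => Or.inl (hall i), fun _ _ => rfl⟩
      push Not at hall
      obtain ⟨a, ha⟩ := hall
      have huniq (i : ι) (hi : ¬ p i) : i = a := by
        have := Fintype.card_le_one_iff.1 (Nat.le_of_lt_succ hm) ⟨i, hi⟩ ⟨a, ha⟩
        exact congrArg Subtype.val this
      have hcard : 1 < Fintype.card ι := by
        have : 0 < Fintype.card ι := Fintype.card_pos_iff.2 ⟨a⟩
        have : Fintype.card ι ≠ 1 := fun h1 => h ⟨h1, a, ha⟩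
        lia
      obtain ⟨b, hb⟩ := Fintype.exists_ne_of_one_lt_card hcard a
      have hpb : p b := by
        by_contra hpb
        exact hb (huniq b hpb)
      refine ⟨fun i => if p i then Sum.inl i else Sum.inl b, fun i => ?_, fun i hi => by simp [hi]⟩
      by_cases hi : p i
      · exact Or.inl hi
      · refine Or.inr ⟨b, fun hbi => hi (hbi ▸ hpb), ?_⟩
        simp [hi]
    obtain ⟨f, hf, hfp⟩ := hkey
    refine ⟨f, hf, ?_⟩
    have h0 : Fintype.card {i // ¬ p i} / 2 = 0 := by lia
    rw [h0, add_zero, ← Finset.card_map (Function.Embedding.inl : ι ↪ ι ⊕ ℕ)]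
    refine Finset.card_le_card fun x hx => ?_
    obtain ⟨i, hi, rfl⟩ := Finset.mem_map.1 hx
    exact Finset.mem_image.2 ⟨i, Finset.mem_univ _, hfp i (Finset.mem_filter.1 hi).2⟩
  · set m := Fintype.card {i // ¬ p i}
    let e : {i // ¬ p i} ≃ Fin m := Fintype.equivFin _
    let f : ι → ι ⊕ ℕ := fun i =>
      if hi : p i then Sum.inl i else Sum.inr (min ((e ⟨i, hi⟩ : ℕ) / 2) (m / 2 - 1))
    have hfsymm (q : Fin m) : f (e.symm q) = Sum.inr (min ((q : ℕ) / 2) (m / 2 - 1)) := by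
      simp [f, (e.symm q).2]
    refine ⟨f, fun i => ?_, ?_⟩
    · by_cases hi : p i
      · exact Or.inl hi
      · obtain ⟨q, hq⟩ : ∃ q, i = e.symm q := ⟨e ⟨i, hi⟩, by simp⟩
        have hqm := q.2
        obtain ⟨r, hr, hrq, hdiv⟩ : ∃ r, r < m ∧ r ≠ q ∧
            min (r / 2) (m / 2 - 1) = min ((q : ℕ) / 2) (m / 2 - 1) := by
          by_cases hcase : (q : ℕ) % 2 = 0 ∧ (q : ℕ) + 1 < m
          · exact ⟨q + 1, by omega, by omega, by omega⟩
          · exact ⟨q - 1, by omega, by omega, by omega⟩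
        refine Or.inr ⟨e.symm ⟨r, hr⟩, ?_, ?_⟩
        · rw [hq]
          intro heq
          have := e.symm.injective (Subtype.ext heq)
          exact hrq (congrArg Fin.val this)
        · rw [hq, hfsymm, hfsymm]
          simp only [hdiv]
    · have hcard : (Finset.univ.filter p).card + m / 2 =
          ((Finset.univ.filter p).disjSum (Finset.range (m / 2))).card := by simp
      rw [hcard]
      refine Finset.card_le_card fun x hx => ?_
      obtain ⟨i, hi, rfl⟩ | ⟨q, hq, rfl⟩ := Finset.mem_disjSum.1 hx
      · have hi' : p i := (Finset.mem_filter.1 hi).2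
        exact Finset.mem_image.2 ⟨i, Finset.mem_univ _, by simp [f, hi']⟩
      · have hq' := Finset.mem_range.1 hq
        refine Finset.mem_image.2 ⟨e.symm ⟨2 * q, by omega⟩, Finset.mem_univ _, ?_⟩
        rw [hfsymm]
        congr 1
        simp only
        omega

/-- For a pairwise `(> 1/2)`-dense instance of Steiner forest without Steiner
nodes (the disjoint nonempty terminal sets `T₁, …, T_k` cover `V(G)`, and every vertex of
`T i` has strictly more than `|T j|/2` neighbours in every other `T j`), with `t` the number
of trivial terminal sets (those inducing a connected subgraph), and provided it is not the
case that `k = 1` with `T₁` non-trivial, the minimum size of a Steiner forest equals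
`|V(G)| − t − ⌊(k − t)/2⌋`. -/
theorem dense_steiner_forest_optimum_value {V : Type*} [Fintype V] [DecidableEq V]
    (G : SimpleGraph V) [DecidableRel G.Adj]
    {k : ℕ} (hk : 1 ≤ k) (T : Fin k → Finset V)
    (hdisj : ∀ i j, i ≠ j → Disjoint (T i) (T j))
    (hne : ∀ i, (T i).Nonempty)
    (hcover : Finset.univ.biUnion T = (Finset.univ : Finset V))
    (hdense : ∀ i j, i ≠ j → ∀ v ∈ T i,
      ((T j).card : ℝ) / 2 < (((T j).filter (fun w => G.Adj v w)).card : ℝ))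
    (t : ℕ) (ht : t = {i : Fin k | (G.induce ((T i : Set V))).Connected}.ncard)
    (hnontriv : ¬ (k = 1 ∧ ∃ i, ¬ (G.induce ((T i : Set V))).Connected)) :
    IsLeast {n : ℕ | ∃ F : SimpleGraph V, IsSteinerForest G T F ∧ F.edgeSet.ncard = n}
      (Fintype.card V - t - (k - t) / 2) := by
  classical
  choose idx hidx using fun v : V => by
    have hv : v ∈ Finset.univ.biUnion T := hcover ▸ Finset.mem_univ v
    exact (Finset.mem_biUnion.1 hv).imp fun i hi => hi.2
  have hmem (v : V) (i : Fin k) : v ∈ T i ↔ idx v = i := by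
    refine ⟨fun hv => ?_, fun h => h ▸ hidx v⟩
    by_contra hne'
    exact Finset.disjoint_left.1 (hdisj _ _ hne') (hidx v) hv
  have hcommon (i j : Fin k) (hij : i ≠ j) (u v : V) (hu : u ∈ T i) (hv : v ∈ T i) :
      ∃ w ∈ T j, G.Adj u w ∧ G.Adj v w := by
    have hlt : (T j).card < ((T j).filter (fun w => G.Adj u w)).card +
        ((T j).filter (fun w => G.Adj v w)).card := by
      have h1 := hdense i j hij u hu
      have h2 := hdense i j hij v hv
      have : ((T j).card : ℝ) < (((T j).filter (fun w => G.Adj u w)).card : ℝ) +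
        (((T j).filter (fun w => G.Adj v w)).card : ℝ) := by linarith
      exact_mod_cast this
    obtain ⟨w, hw⟩ := Finset.inter_nonempty_of_card_lt_card_add_card
      (Finset.filter_subset _ _) (Finset.filter_subset _ _) hlt
    simp only [Finset.mem_inter, Finset.mem_filter] at hw
    exact ⟨w, hw.1.1, hw.1.2, hw.2.2⟩
  set p : Fin k → Prop := fun i => (G.induce ((T i : Set V))).Connected with hp
  have htp : t = (Finset.univ.filter p).card := by
    rw [ht, Set.ncard_eq_toFinset_card']
    congr 1
    ext i
    simp [hp]
  have htk : (Finset.univ.filter p).card + Fintype.card {i // ¬ p i} = k := by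
    rw [Fintype.card_subtype, Finset.card_filter_add_card_filter_not, Finset.card_univ,
      Fintype.card_fin]
  have hupper (F : SimpleGraph V) (hF : IsSteinerForest G T F) :
      2 * Nat.card F.ConnectedComponent ≤ k + t := by
    obtain ⟨hFG, -, hconn⟩ := hF
    choose x hx using hne
    have hcomp (v : V) : F.connectedComponentMk (x (idx v)) = F.connectedComponentMk v :=
      SimpleGraph.ConnectedComponent.sound (hconn _ _ (hx _) _ (hidx v))
    have := two_mul_card_le_of_surjective p (fun i => F.connectedComponentMk (x i))
      (fun c => by
        obtain ⟨v, rfl⟩ := c.exists_rep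
        exact ⟨idx v, hcomp v⟩)
      (fun i hi => by
        have hsupp : (F.connectedComponentMk (x i)).supp = (T i : Set V) := by
          ext v
          rw [SimpleGraph.ConnectedComponent.mem_supp_iff, Finset.mem_coe]
          constructor
          · intro hv
            exact (hmem v i).2 (hi (idx v) ((hcomp v).trans hv))
          · intro hv
            exact SimpleGraph.ConnectedComponent.sound (hconn i _ hv _ (hx i))
        have hc := (F.connectedComponentMk (x i)).maximal_connected_induce_supp.prop
        rw [hsupp] at hc
        exact hc.mono (SimpleGraph.comap_monotone _ hFG))
    rwa [← htp, Fintype.card_fin, ← Nat.card_eq_fintype_card] at this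
  constructor
  · obtain ⟨f, hf, hcard⟩ := exists_grouping p (by simpa [hp] using hnontriv)
    let H : SimpleGraph V :=
      { Adj := fun u v => G.Adj u v ∧ f (idx u) = f (idx v)
        symm := ⟨fun u v h => ⟨h.1.symm, h.2.symm⟩⟩
        loopless := ⟨fun u h => h.1.ne rfl⟩ }
    obtain ⟨F, hFH, hacyc, hreach⟩ := H.exists_isAcyclic_reachable_eq_le
    have hforest : IsSteinerForest G T F := by
      refine ⟨fun u v h => (hFH h).1, hacyc, fun i u hu v hv => ?_⟩
      rw [hreach]
      rcases hf i with hi | ⟨j, hji, hfj⟩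
      · let φ : G.induce ((T i : Set V)) →g H :=
          { toFun := Subtype.val
            map_rel' := fun {a b} hab => ⟨hab, by
              rw [(hmem a i).1 a.2, (hmem b i).1 b.2]⟩ }
        exact (hi.preconnected ⟨u, hu⟩ ⟨v, hv⟩).map φ
      · obtain ⟨w, hw, huw, hvw⟩ := hcommon i j hji.symm u v hu hv
        have hadj (a : V) (ha : a ∈ T i) (haw : G.Adj a w) : H.Adj a w :=
          ⟨haw, by rw [(hmem a i).1 ha, (hmem w j).1 hw, hfj]⟩
        exact (hadj u hu huw).reachable.trans (hadj v hv hvw).symm.reachable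
    refine ⟨F, hforest, ?_⟩
    have hedges := hacyc.ncard_edgeSet_add_card_connectedComponent
    have hle := hupper F hforest
    have hge := SimpleGraph.card_image_le_card_connectedComponent (H := F)
      (fun v => f (idx v)) fun u v h => (hFH h).2
    have himage : Finset.univ.image (fun v => f (idx v)) = Finset.univ.image f := by
      have hsurj : Function.Surjective idx := fun i => by
        obtain ⟨v, hv⟩ := hne i
        exact ⟨v, (hmem v i).1 hv⟩
      rw [← Finset.image_univ_of_surjective hsurj, Finset.image_image]
      rfl
    rw [himage] at hge
    omega
  · rintro n ⟨F, hF, rfl⟩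
    have hedges := hF.2.1.ncard_edgeSet_add_card_connectedComponent
    have hle := hupper F hF
    omega
end

section
/- Let G be a finite simple graph and let T₁,…,T_k (k ≥ 1) be pairwise disjoint nonempty subsets of V(G) with T₁ ∪ … ∪ T_k = V(G), such that for all i ≠ j, every vertex of T_i has strictly more than |T_j|/2 neighbours in T_j, and assume at least one Steiner forest for (G; T₁,…,T_k) exists. Then there exists a minimum Steiner forest in which every connected component has rank at most 3 and at most one connected component has rank exactly 3. -/
/-- The rank of a connected component `C` of a forest `F`: the number of indices `i` such
that `C` contains a vertex of `T i`. -/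
noncomputable def compRank {V : Type*} {k : ℕ} (T : Fin k → Finset V) (F : SimpleGraph V)
    (C : F.ConnectedComponent) : ℕ :=
  {i : Fin k | ∃ v ∈ T i, F.connectedComponentMk v = C}.ncard

/-- The number of edges plus the number of components of a forest is the number of vertices. -/
lemma SimpleGraph.IsAcyclic.ncard_edgeSet_add_card_connectedComponent_s9 {V : Type*} [Finite V]
    {F : SimpleGraph V} (hF : F.IsAcyclic) :
    F.edgeSet.ncard + Nat.card F.ConnectedComponent = Nat.card V := by
  classical
  have := Fintype.ofFinite V
  have hcomp (C : F.ConnectedComponent) :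
      ∑ v with F.connectedComponentMk v = C, F.degree v + 2 =
        2 * Finset.card {v | F.connectedComponentMk v = C} := by
    have htree : 2 * C.toSimpleGraph.edgeFinset.card + 2 = 2 * Fintype.card C := by
      rw [← (hF.isTree_connectedComponent C).card_edgeFinset]; ring
    have hdeg (v : C) : C.toSimpleGraph.degree v = F.degree v := by
      rw [← SimpleGraph.card_neighborFinset_eq_degree, ← SimpleGraph.card_neighborFinset_eq_degree]
      refine Finset.card_bij (fun w _ ↦ (w : V)) ?_ ?_ ?_
      · intro w hw
        simpa using! hw
      · intro a _ b _ h
        exact Subtype.ext h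
      · intro w hw
        have hw : F.Adj v w := by simpa using hw
        exact ⟨⟨w, C.mem_supp_of_adj_mem_supp v.2 hw⟩, by simpa using! hw, rfl⟩
    rw [← SimpleGraph.sum_degrees_eq_twice_card_edges, Finset.sum_congr rfl fun v _ ↦ hdeg v]
      at htree
    rw [← Finset.sum_subtype (p := (· ∈ C)) {v | F.connectedComponentMk v = C}
      (fun v ↦ by simp; rfl) (fun v ↦ F.degree v)] at htree
    rw [htree, Fintype.card_of_subtype (p := (· ∈ C)) {v | F.connectedComponentMk v = C}
      (fun v ↦ by simp; rfl)]
  have hsum := Finset.sum_congr (rfl : (Finset.univ : Finset F.ConnectedComponent) = _)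
    fun C _ ↦ hcomp C
  rw [Finset.sum_add_distrib,
    Finset.sum_fiberwise Finset.univ F.connectedComponentMk fun v ↦ F.degree v, ← Finset.mul_sum,
    ← Finset.card_eq_sum_card_fiberwise (f := F.connectedComponentMk) (s := Finset.univ)
      (fun _ _ ↦ Finset.mem_coe.2 (Finset.mem_univ _)),
    SimpleGraph.sum_degrees_eq_twice_card_edges, ← Set.ncard_coe_finset,
    SimpleGraph.coe_edgeFinset] at hsum
  simp only [Finset.sum_const, Finset.card_univ, smul_eq_mul] at hsum
  rw [Nat.card_eq_fintype_card, Nat.card_eq_fintype_card]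
  omega

/-- If every vertex of `A` is adjacent to more than half of `B`, then any two vertices of `A` have
a common neighbour. -/
lemma SimpleGraph.reachable_of_card_div_two_lt {V : Type*} [DecidableEq V] (H : SimpleGraph V)
    [DecidableRel H.Adj] {A B : Finset V}
    (h : ∀ a ∈ A, (B.card : ℝ) / 2 < ((B.filter (fun b ↦ H.Adj a b)).card : ℝ))
    {u v : V} (hu : u ∈ A) (hv : v ∈ A) : H.Reachable u v := by
  have hlt : B.card < (B.filter (fun b ↦ H.Adj u b)).card +
      (B.filter (fun b ↦ H.Adj v b)).card := by
    have h₁ := h u hu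
    have h₂ := h v hv
    have : (B.card : ℝ) < (B.filter (fun b ↦ H.Adj u b)).card +
      (B.filter (fun b ↦ H.Adj v b)).card := by linarith
    exact_mod_cast this
  obtain ⟨w, hw⟩ := Finset.inter_nonempty_of_card_lt_card_add_card
    (Finset.filter_subset _ _) (Finset.filter_subset _ _) hlt
  simp only [Finset.mem_inter, Finset.mem_filter] at hw
  exact hw.1.2.reachable.trans hw.2.2.symm.reachable

/-- In a dense instance with a minimum Steiner forest, one cannot take two terminal sets out of
their components so that each of those components keeps at least two terminal sets: merging the
two would give a Steiner forest with one more component. -/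
lemma not_splittable_of_minimum {V : Type*} [Fintype V] [DecidableEq V]
    {G : SimpleGraph V} [DecidableRel G.Adj] {k : ℕ} {T : Fin k → Finset V}
    (hne : ∀ i, (T i).Nonempty)
    (hdense : ∀ i j, i ≠ j → ∀ v ∈ T i,
      ((T j).card : ℝ) / 2 < (((T j).filter (fun w => G.Adj v w)).card : ℝ))
    {F : SimpleGraph V} (hF : IsSteinerForest G T F)
    (hmin : ∀ F' : SimpleGraph V, IsSteinerForest G T F' → F.edgeSet.ncard ≤ F'.edgeSet.ncard)
    {idx : V → Fin k} (hidx : ∀ v i, v ∈ T i ↔ idx v = i)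
    {comp : Fin k → F.ConnectedComponent} (hcomp : ∀ v, F.connectedComponentMk v = comp (idx v))
    {a b : Fin k} (hab : a ≠ b)
    (hrest : ∀ x, comp x = comp a ∨ comp x = comp b → ∃ y z, y ≠ z ∧ comp y = comp x ∧
      comp z = comp x ∧ y ≠ a ∧ y ≠ b ∧ z ≠ a ∧ z ≠ b) : False := by
  classical
  let lab : Fin k → Option F.ConnectedComponent :=
    fun i ↦ if i = a ∨ i = b then none else some (comp i)
  let H : SimpleGraph V :=
    { Adj := fun u v ↦ G.Adj u v ∧ lab (idx u) = lab (idx v)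
      symm := ⟨fun _ _ h ↦ ⟨h.1.symm, h.2.symm⟩⟩
      loopless := ⟨fun _ h ↦ G.loopless.irrefl _ h.1⟩ }
  have hpair {i j : Fin k} (hij : i ≠ j) (hl : lab i = lab j) {u v : V} (hu : u ∈ T i)
      (hv : v ∈ T i) : H.Reachable u v := by
    refine H.reachable_of_card_div_two_lt (A := T i) (B := T j) (fun x hx ↦ ?_) hu hv
    convert hdense i j hij x hx using 4 with w hw
    have hx := (hidx _ _).1 hx
    have hw := (hidx _ _).1 hw
    simp [H, hx, hw, hl]
  have hreach : ∀ i, ∀ u ∈ T i, ∀ v ∈ T i, H.Reachable u v := by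
    intro i u hu v hv
    by_cases hia : i = a
    · subst hia
      exact hpair hab (by simp [lab]) hu hv
    by_cases hib : i = b
    · subst hib
      exact hpair hab.symm (by simp [lab]) hu hv
    by_cases hi : comp i = comp a ∨ comp i = comp b
    · obtain ⟨y, z, hyz, hy, hz, hya, hyb, hza, hzb⟩ := hrest i hi
      by_cases hiy : i = y
      · exact hpair (j := z) (by grind) (by simp [lab, *]) hu hv
      · exact hpair (j := y) hiy (by simp [lab, *]) hu hv
    · have key : ∀ {x y : V}, F.Walk x y → comp (idx x) = comp i → H.Reachable x y := by
        intro x y p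
        induction p with
        | nil => intro _; exact .rfl
        | @cons x w y hxw p ih =>
          intro hx
          have hw : comp (idx w) = comp i := by
            rw [← hcomp, ← SimpleGraph.ConnectedComponent.connectedComponentMk_eq_of_adj hxw,
              hcomp, hx]
          refine SimpleGraph.Reachable.trans (SimpleGraph.Adj.reachable ?_) (ih hw)
          refine ⟨hF.1 hxw, ?_⟩
          have hout {j : Fin k} (hj : comp j = comp i) : lab j = some (comp i) := by
            have : ¬ (j = a ∨ j = b) := by
              rintro (rfl | rfl) <;> simp [hj] at hi
            simp [lab, this, hj]
          rw [hout hx, hout hw]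
      obtain ⟨p⟩ := hF.2.2 i u hu v hv
      exact key p (by rw [(hidx u i).1 hu])
  obtain ⟨F', hF'H, hF'ac, hF're⟩ := H.exists_isAcyclic_reachable_eq_le
  have hF' : IsSteinerForest G T F' :=
    ⟨hF'H.trans fun _ _ h ↦ h.1, hF'ac, by rw [hF're]; exact hreach⟩
  have hlab : ∀ {x y : V}, F'.Walk x y → lab (idx x) = lab (idx y) := by
    intro x y p
    induction p with
    | nil => rfl
    | cons h _ ih => exact (hF'H h).2.trans ih
  let f : F'.ConnectedComponent → Option F.ConnectedComponent :=
    SimpleGraph.ConnectedComponent.lift (fun v ↦ lab (idx v)) fun _ _ p _ ↦ hlab p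
  have hf : Function.Surjective f := by
    have hT (i : Fin k) : ∃ C, f C = lab i := by
      obtain ⟨v, hv⟩ := hne i
      exact ⟨F'.connectedComponentMk v, by rw [← (hidx v i).1 hv]; rfl⟩
    rintro (_ | C)
    · simpa [lab] using hT a
    · induction C using SimpleGraph.ConnectedComponent.ind with | h v =>
      rw [hcomp]
      by_cases hv : idx v = a ∨ idx v = b
      · obtain ⟨y, -, -, hy, -, hya, hyb, -⟩ := hrest (idx v) (by grind)
        simpa [lab, hya, hyb, hy] using hT y
      · simpa [lab, hv] using hT (idx v)
  have hcard := Nat.card_le_card_of_surjective f hf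
  rw [Finite.card_option] at hcard
  have h₁ := hF.2.1.ncard_edgeSet_add_card_connectedComponent_s9
  have h₂ := hF'ac.ncard_edgeSet_add_card_connectedComponent_s9
  have h₃ := hmin F' hF'
  omega

/-- For a pairwise `(> 1/2)`-dense instance of Steiner forest without Steiner
nodes (the disjoint nonempty terminal sets cover `V(G)`, and every vertex of `T i` has
strictly more than `|T j|/2` neighbours in every other `T j`), if some Steiner forest exists
then there is a minimum Steiner forest in which every connected component has rank at most 3
and at most one connected component has rank exactly 3. -/
theorem dense_steiner_forest_rank_structure {V : Type*} [Fintype V] [DecidableEq V]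
    (G : SimpleGraph V) [DecidableRel G.Adj]
    {k : ℕ} (hk : 1 ≤ k) (T : Fin k → Finset V)
    (hdisj : ∀ i j, i ≠ j → Disjoint (T i) (T j))
    (hne : ∀ i, (T i).Nonempty)
    (hcover : Finset.univ.biUnion T = (Finset.univ : Finset V))
    (hdense : ∀ i j, i ≠ j → ∀ v ∈ T i,
      ((T j).card : ℝ) / 2 < (((T j).filter (fun w => G.Adj v w)).card : ℝ))
    (hex : ∃ F, IsSteinerForest G T F) :
    ∃ F : SimpleGraph V, IsSteinerForest G T F ∧
      (∀ F' : SimpleGraph V, IsSteinerForest G T F' → F.edgeSet.ncard ≤ F'.edgeSet.ncard) ∧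
      (∀ C : F.ConnectedComponent, compRank T F C ≤ 3) ∧
      {C : F.ConnectedComponent | compRank T F C = 3}.Subsingleton := by
  classical
  obtain ⟨F, hF, hmin⟩ : ∃ F, IsSteinerForest G T F ∧
      ∀ F', IsSteinerForest G T F' → F.edgeSet.ncard ≤ F'.edgeSet.ncard := by
    obtain ⟨F, hF, hmin⟩ := Set.exists_min_image {F | IsSteinerForest G T F}
      (fun F ↦ F.edgeSet.ncard) (Set.toFinite _) hex
    exact ⟨F, hF, hmin⟩
  have hcov (v : V) : ∃ i, v ∈ T i := by
    have := hcover ▸ Finset.mem_univ v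
    simpa using this
  choose idx hmem using hcov
  have hidx (v : V) (i : Fin k) : v ∈ T i ↔ idx v = i := by
    refine ⟨fun hv ↦ ?_, fun h ↦ h ▸ hmem v⟩
    by_contra hvi
    exact Finset.disjoint_left.1 (hdisj _ _ hvi) (hmem v) hv
  choose t ht using hne
  let comp : Fin k → F.ConnectedComponent := fun i ↦ F.connectedComponentMk (t i)
  have hcomp (v : V) : F.connectedComponentMk v = comp (idx v) :=
    SimpleGraph.ConnectedComponent.sound (hF.2.2 _ _ (hmem v) _ (ht _))
  have hrank (C : F.ConnectedComponent) :
      compRank T F C = (Finset.univ.filter (fun i ↦ comp i = C)).card := by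
    rw [compRank, ← Set.ncard_coe_finset]
    congr 1
    ext i
    simp only [Set.mem_ofPred_eq, Finset.coe_filter, Finset.mem_univ, true_and]
    constructor
    · rintro ⟨v, hv, rfl⟩
      rw [hcomp, (hidx v i).1 hv]
    · exact fun h ↦ ⟨t i, ht i, h⟩
  refine ⟨F, hF, hmin, fun C ↦ ?_, fun C hC D hD ↦ ?_⟩
  · by_contra! hC
    rw [hrank] at hC
    obtain ⟨S, hSC, hS⟩ := Finset.exists_subset_card_eq (Nat.succ_le_of_lt hC)
    obtain ⟨a, b, c, d, hab, hac, had, hbc, hbd, hcd, rfl⟩ := Finset.card_eq_four.1 hS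
    simp only [Finset.insert_subset_iff, Finset.singleton_subset_iff, Finset.mem_filter,
      Finset.mem_univ, true_and] at hSC
    refine not_splittable_of_minimum (fun i ↦ ⟨t i, ht i⟩) hdense hF hmin hidx hcomp hab
      fun x hx ↦ ⟨c, d, ?_⟩
    grind
  · by_contra hCD
    rw [Set.mem_ofPred_eq, hrank, Finset.card_eq_three] at hC hD
    obtain ⟨a, a', a'', h₁, h₂, h₃, hA⟩ := hC
    obtain ⟨b, b', b'', h₄, h₅, h₆, hB⟩ := hD
    simp only [Finset.ext_iff, Finset.mem_filter, Finset.mem_univ, true_and, Finset.mem_insert,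
      Finset.mem_singleton] at hA hB
    have ha : comp a = C := by simp [hA]
    have hb : comp b = D := by simp [hB]
    have ha' : comp a' = C := by simp [hA]
    have hb' : comp b' = D := by simp [hB]
    have ha'' : comp a'' = C := by simp [hA]
    have hb'' : comp b'' = D := by simp [hB]
    refine not_splittable_of_minimum (a := a) (b := b) (fun i ↦ ⟨t i, ht i⟩) hdense hF hmin hidx
      hcomp (by grind) fun x hx ↦ ?_
    rcases hx with hx | hx
    · exact ⟨a', a'', by grind⟩
    · exact ⟨b', b'', by grind⟩
end
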